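/- arXiv:1308.6686 — 2 statements merged into one kernel-verified Lean document; each statement's English description precedes it below -/
import Mathlib

section
/- Suppose F is of type ℱ and 𝐄F = 0. Then all the integrals defining 𝐑_∞F converge absolutely, 𝐑_∞F is bounded on {(x,θ₀,ξ_d): θ₀ ∈ ℝ, ξ_d ≥ 0}, and L̃(∂_{θ₀},∂_{ξ_d})(𝐑_∞F) = F. Moreover, if in addition F is C¹ and L̃(∂_{θ₀},∂_{ξ_d})F is of type ℱ, then 𝐑_∞(L̃(∂_{θ₀},∂_{ξ_d})F) = F as well. -/
open MeasureTheory Filter Set Matrix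
open scoped ENNReal Topology

noncomputable section


/-- A `C¹` function of `(x,θ)` which decays, together with its first-order derivatives,
like `⟨θ⟩⁻² = (1+θ²)⁻¹`, uniformly in `x`. -/
def Decay2 (d : ℕ) (f : (Fin (d+1) → ℝ) × ℝ → ℝ) : Prop :=
  ContDiff ℝ 1 f ∧
  ∃ C : ℝ, ∀ (x : Fin (d+1) → ℝ) (θ : ℝ),
    (1 + θ ^ 2) * |f (x, θ)| ≤ C ∧ (1 + θ ^ 2) * ‖fderiv ℝ f (x, θ)‖ ≤ C

/-- Functions of type `ℱ`. -/
def IsTypeF (d : ℕ) (ω : Fin 3 → ℝ) (r : Fin 3 → Fin 3 → ℝ)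
    (F : (Fin (d+1) → ℝ) × ℝ × ℝ → Fin 3 → ℝ) : Prop :=
  ∃ f : Fin 3 → Fin 3 → (Fin (d+1) → ℝ) × ℝ → ℝ,
  ∃ g h : Fin 3 → Fin 3 → Fin 3 → (Fin (d+1) → ℝ) × ℝ → ℝ,
    (∀ i k, Decay2 d (f i k)) ∧ (∀ i lo m, Decay2 d (g i lo m)) ∧
    (∀ i lo m, Decay2 d (h i lo m)) ∧
    ∀ (x : Fin (d+1) → ℝ) (θ₀ ξd : ℝ),
      F (x, θ₀, ξd) = ∑ i : Fin 3,
        ((∑ k : Fin 3, f i k (x, θ₀ + ω k * ξd)) +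
          ∑ lo : Fin 3, ∑ m : Fin 3, if lo ≤ m then
            g i lo m (x, θ₀ + ω lo * ξd) * h i lo m (x, θ₀ + ω m * ξd) else 0) • r i

/-- `𝐄F = 0`: all the defining limits of `𝐄F` exist and vanish. -/
def EZero (d : ℕ) (ω : Fin 3 → ℝ) (l : Fin 3 → Fin 3 → ℝ)
    (F : (Fin (d+1) → ℝ) × ℝ × ℝ → Fin 3 → ℝ) : Prop :=
  ∀ (j : Fin 3) (x : Fin (d+1) → ℝ) (θ₀ ξd : ℝ),
    Tendsto (fun S : ℝ => S⁻¹ * ∫ s in (0:ℝ)..S, l j ⬝ᵥ F (x, θ₀ + ω j * (ξd - s), s))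
      atTop (𝓝 0)

/-- The operator `𝐄`, defined via (possibly junk) limits. -/
def Eop3 (d : ℕ) (ω : Fin 3 → ℝ) (l r : Fin 3 → Fin 3 → ℝ)
    (F : (Fin (d+1) → ℝ) × ℝ × ℝ → Fin 3 → ℝ) : (Fin (d+1) → ℝ) × ℝ × ℝ → Fin 3 → ℝ :=
  fun p => ∑ j : Fin 3,
    (limUnder atTop (fun S : ℝ =>
      S⁻¹ * ∫ s in (0:ℝ)..S, l j ⬝ᵥ F (p.1, p.2.1 + ω j * (p.2.2 - s), s))) • r j

/-- The operator `𝐑_∞`. -/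
def Rinf3 (d : ℕ) (ω : Fin 3 → ℝ) (l r : Fin 3 → Fin 3 → ℝ)
    (F : (Fin (d+1) → ℝ) × ℝ × ℝ → Fin 3 → ℝ) : (Fin (d+1) → ℝ) × ℝ × ℝ → Fin 3 → ℝ :=
  fun p => -∑ i : Fin 3,
    (∫ s in Ici p.2.2, l i ⬝ᵥ F (p.1, p.2.1 + ω i * (p.2.2 - s), s)) • r i

/-- `U` solves `L̃(∂_{θ₀},∂_{ξ_d}) U = F` componentwise:
`∂_{ξ_d}(l_i·U) - ω_i ∂_{θ₀}(l_i·U) = l_i·F`. -/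
def SolvesLtilde (d : ℕ) (ω : Fin 3 → ℝ) (l : Fin 3 → Fin 3 → ℝ)
    (U F : (Fin (d+1) → ℝ) × ℝ × ℝ → Fin 3 → ℝ) : Prop :=
  ∀ (i : Fin 3) (x : Fin (d+1) → ℝ) (θ₀ ξd : ℝ), 0 ≤ ξd →
    ∃ A B : ℝ,
      HasDerivAt (fun u : ℝ => l i ⬝ᵥ U (x, u, ξd)) A θ₀ ∧
      HasDerivAt (fun u : ℝ => l i ⬝ᵥ U (x, θ₀, u)) B ξd ∧
      B - ω i * A = l i ⬝ᵥ F (x, θ₀, ξd)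

/-- The operator `L̃(∂_{θ₀},∂_{ξ_d})`, computed with (possibly junk) `fderiv`s. -/
def LtildeTheta (d : ℕ) (ω : Fin 3 → ℝ) (l r : Fin 3 → Fin 3 → ℝ)
    (U : (Fin (d+1) → ℝ) × ℝ × ℝ → Fin 3 → ℝ) : (Fin (d+1) → ℝ) × ℝ × ℝ → Fin 3 → ℝ :=
  fun p => ∑ i : Fin 3,
    ((fderiv ℝ (fun q : ℝ × ℝ => l i ⬝ᵥ U (p.1, q.1, q.2)) (p.2.1, p.2.2)) (0, 1)
      - ω i * (fderiv ℝ (fun q : ℝ × ℝ => l i ⬝ᵥ U (p.1, q.1, q.2)) (p.2.1, p.2.2)) (1, 0)) • r i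


/-- A function of `(x, φ, s)` with all the integrability properties along characteristics. -/
structure Nice {X : Type*} (G : X → ℝ → ℝ → ℝ) : Prop where
  int : ∀ x φ, Integrable (G x φ)
  bdd : ∃ C : ℝ, ∀ x φ, ∫ s, |G x φ s| ≤ C
  cont : ∀ x, Continuous (fun p : ℝ × ℝ => G x p.1 p.2)
  tend : ∀ x φ, Tendsto (G x φ) atTop (𝓝 0)
  der : ∃ G' : X → ℝ → ℝ → ℝ, (∀ x φ s, HasDerivAt (fun u => G x u s) (G' x φ s) φ) ∧
    (∀ x φ, Continuous (G' x φ)) ∧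
    (∀ x φ, ∃ b : ℝ → ℝ, Integrable b ∧ ∀ s, ∀ u ∈ Metric.ball φ 1, |G' x u s| ≤ b s)

theorem Nice.zero {X : Type*} : Nice (fun (_ : X) (_ _ : ℝ) => (0 : ℝ)) where
  int := fun _ _ => integrable_zero _ _ _
  bdd := ⟨0, fun _ _ => by simp⟩
  cont := fun _ => continuous_const
  tend := fun _ _ => tendsto_const_nhds
  der := ⟨fun _ _ _ => 0, fun _ φ _ => hasDerivAt_const φ 0, fun _ _ => continuous_const,
    fun _ _ => ⟨fun _ => 0, integrable_zero _ _ _, by simp⟩⟩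

theorem Nice.add {X : Type*} {G H : X → ℝ → ℝ → ℝ} (hG : Nice G) (hH : Nice H) :
    Nice (fun x φ s => G x φ s + H x φ s) where
  int := fun x φ => (hG.int x φ).add (hH.int x φ)
  bdd := by
    obtain ⟨C, hC⟩ := hG.bdd
    obtain ⟨D, hD⟩ := hH.bdd
    refine ⟨C + D, fun x φ => ?_⟩
    calc ∫ s, |G x φ s + H x φ s| ≤ ∫ s, (|G x φ s| + |H x φ s|) :=
          integral_mono ((hG.int x φ).add (hH.int x φ)).abs
            ((hG.int x φ).abs.add (hH.int x φ).abs) (fun s => abs_add_le _ _)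
      _ = (∫ s, |G x φ s|) + ∫ s, |H x φ s| :=
          integral_add (hG.int x φ).abs (hH.int x φ).abs
      _ ≤ C + D := add_le_add (hC x φ) (hD x φ)
  cont := fun x => (hG.cont x).add (hH.cont x)
  tend := fun x φ => by simpa using (hG.tend x φ).add (hH.tend x φ)
  der := by
    obtain ⟨G', h1, h2, h3⟩ := hG.der
    obtain ⟨H', k1, k2, k3⟩ := hH.der
    refine ⟨fun x φ s => G' x φ s + H' x φ s, fun x φ s => (h1 x φ s).add (k1 x φ s),
      fun x φ => (h2 x φ).add (k2 x φ), fun x φ => ?_⟩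
    obtain ⟨b, hb, hb'⟩ := h3 x φ
    obtain ⟨e, he, he'⟩ := k3 x φ
    exact ⟨fun s => b s + e s, hb.add he, fun s u hu =>
      (abs_add_le _ _).trans (add_le_add (hb' s u hu) (he' s u hu))⟩

theorem Nice.sum {X ι : Type*} (S : Finset ι) {G : ι → X → ℝ → ℝ → ℝ}
    (hG : ∀ i, Nice (G i)) : Nice (fun x φ s => ∑ i ∈ S, G i x φ s) := by
  classical
  induction S using Finset.induction_on with
  | empty => simpa using Nice.zero
  | insert a S ha ih =>
    simp only [Finset.sum_insert ha]
    exact (hG a).add ih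

theorem integrable_phase (δ φ : ℝ) (hδ : δ ≠ 0) :
    Integrable (fun s : ℝ => (1 + (φ + δ * s) ^ 2)⁻¹) := by
  have h := (integrable_inv_one_add_sq.comp_add_left φ).comp_mul_left' hδ
  exact h

theorem integral_phase (δ φ : ℝ) :
    ∫ s : ℝ, (1 + (φ + δ * s) ^ 2)⁻¹ = |δ⁻¹| * Real.pi := by
  have h := Measure.integral_comp_mul_left (fun s : ℝ => (1 + (φ + s) ^ 2)⁻¹) δ
  have h2 := integral_add_left_eq_self (μ := volume) (fun s : ℝ => (1 + s ^ 2)⁻¹) φ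
  rw [h, h2, integral_univ_inv_one_add_sq, smul_eq_mul]

theorem nice_of_bound {X : Type*} (G G' : X → ℝ → ℝ → ℝ) (δ : ℝ) (hδ : δ ≠ 0) (C : ℝ)
    (cont : ∀ x, Continuous (fun p : ℝ × ℝ => G x p.1 p.2))
    (cont' : ∀ x φ, Continuous (G' x φ))
    (hd : ∀ x φ s, HasDerivAt (fun u => G x u s) (G' x φ s) φ)
    (hb : ∀ x φ s, |G x φ s| ≤ C * (1 + (φ + δ * s) ^ 2)⁻¹)
    (hb' : ∀ x φ s, |G' x φ s| ≤ C * (1 + (φ + δ * s) ^ 2)⁻¹) : Nice G := by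
  have hInt : ∀ x φ, Integrable (G x φ) := fun x φ =>
    ((integrable_phase δ φ hδ).const_mul C).mono'
      ((cont x).comp (Continuous.prodMk_right φ)).aestronglyMeasurable
      (Eventually.of_forall fun s => hb x φ s)
  refine ⟨hInt, ⟨C * (|δ⁻¹| * Real.pi), fun x φ => ?_⟩, cont, fun x φ => ?_,
    G', hd, cont', fun x φ => ?_⟩
  · rw [← integral_phase δ φ, ← integral_const_mul]
    exact integral_mono (hInt x φ).abs ((integrable_phase δ φ hδ).const_mul C) (hb x φ)
  · refine squeeze_zero_norm (hb x φ) ?_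
    rw [← mul_zero C]
    refine Tendsto.const_mul C (Tendsto.inv_tendsto_atTop ?_)
    refine tendsto_atTop_add_const_left _ _ ?_
    have h1 : Tendsto (fun s : ℝ => |φ + δ * s|) atTop atTop := by
      rcases lt_or_gt_of_ne hδ with h | h
      · exact tendsto_abs_atBot_atTop.comp
          (tendsto_atBot_add_const_left _ _ (tendsto_id.const_mul_atTop_of_neg h))
      · exact tendsto_abs_atTop_atTop.comp
          (tendsto_atTop_add_const_left _ _ (tendsto_id.const_mul_atTop h))
    have h2 := (tendsto_pow_atTop (α := ℝ) (n := 2) two_ne_zero).comp h1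
    refine h2.congr fun s => ?_
    simp
  · have hC : 0 ≤ C := by
      have := (abs_nonneg _).trans (hb x 0 0)
      simpa using this
    refine ⟨fun s => 3 * C * (1 + (φ + δ * s) ^ 2)⁻¹,
      (integrable_phase δ φ hδ).const_mul _, fun s u hu => (hb' x u s).trans ?_⟩
    show _ ≤ 3 * C * (1 + (φ + δ * s) ^ 2)⁻¹
    rw [mul_comm 3 C, mul_assoc]
    refine mul_le_mul_of_nonneg_left ?_ hC
    rw [← div_eq_mul_inv, inv_eq_one_div, div_le_div_iff₀ (by positivity) (by positivity)]
    have hu' : |u - φ| < 1 := by simpa [Real.dist_eq] using hu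
    obtain ⟨ha, hb⟩ := abs_lt.1 hu'
    have h1 : (u - φ) ^ 2 ≤ 1 := by nlinarith
    nlinarith [sq_nonneg ((u + δ * s) + (u - φ)), sq_nonneg (u + δ * s)]

/-- A one-variable description of the decay. -/
theorem Decay2.data {d : ℕ} {f : (Fin (d+1) → ℝ) × ℝ → ℝ} (hf : Decay2 d f) :
    Continuous f ∧ ∃ f' : (Fin (d+1) → ℝ) × ℝ → ℝ, Continuous f' ∧
      (∀ x θ, HasDerivAt (fun u => f (x, u)) (f' (x, θ)) θ) ∧
      ∃ C : ℝ, 0 ≤ C ∧ ∀ x θ, |f (x, θ)| ≤ C * (1 + θ ^ 2)⁻¹ ∧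
        |f' (x, θ)| ≤ C * (1 + θ ^ 2)⁻¹ := by
  obtain ⟨hc, C, hC⟩ := hf
  refine ⟨hc.continuous, fun p => fderiv ℝ f p (0, 1),
    (hc.continuous_fderiv one_ne_zero).clm_apply continuous_const, fun x θ => ?_, C, ?_,
    fun x θ => ⟨?_, ?_⟩⟩
  · have h1 := (hc.differentiable one_ne_zero (x, θ)).hasFDerivAt
    have h2 : HasDerivAt (fun u : ℝ => (x, u)) ((0 : Fin (d+1) → ℝ), (1 : ℝ)) θ :=
      (hasDerivAt_const θ x).prodMk (hasDerivAt_id θ)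
    exact h1.comp_hasDerivAt θ h2
  · exact le_trans (by positivity) (hC 0 0).1
  · rw [← div_eq_mul_inv, le_div_iff₀ (by positivity), mul_comm]
    exact (hC x θ).1
  · rw [← div_eq_mul_inv, le_div_iff₀ (by positivity), mul_comm]
    refine le_trans (mul_le_mul_of_nonneg_left ?_ (by positivity)) (hC x θ).2
    have := (fderiv ℝ f (x, θ)).le_opNorm ((0 : Fin (d+1) → ℝ), (1 : ℝ))
    have hn : ‖((0 : Fin (d+1) → ℝ), (1 : ℝ))‖ = 1 := by simp [Prod.norm_def]
    rwa [hn, mul_one] at this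

theorem hasDerivAt_shift {f : ℝ → ℝ} {f' c φ : ℝ} (h : HasDerivAt f f' (φ + c)) :
    HasDerivAt (fun u => f (u + c)) f' φ := h.comp_add_const φ c

theorem nice_single {d : ℕ} {f : (Fin (d+1) → ℝ) × ℝ → ℝ} (hf : Decay2 d f) (a : ℝ)
    (ha : a ≠ 0) : Nice (fun x φ s => f (x, φ + a * s)) := by
  obtain ⟨hc, f', hc', hd, C, hC, hb⟩ := hf.data
  refine nice_of_bound _ (fun x φ s => f' (x, φ + a * s)) a ha C (fun x => by fun_prop)
    (fun x φ => by fun_prop) (fun x φ s => ?_) (fun x φ s => (hb x _).1)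
    (fun x φ s => (hb x _).2)
  exact hasDerivAt_shift (f := fun u => f (x, u)) (hd x _)

theorem nice_prod_left {d : ℕ} {g h : (Fin (d+1) → ℝ) × ℝ → ℝ} (hg : Decay2 d g)
    (hh : Decay2 d h) (a b : ℝ) (ha : a ≠ 0) :
    Nice (fun x φ s => g (x, φ + a * s) * h (x, φ + b * s)) := by
  obtain ⟨gc, g', gc', gd, C, hC, gb⟩ := hg.data
  obtain ⟨hc, h', hc', hd, D, hD, hb⟩ := hh.data
  have le1 : ∀ t : ℝ, D * (1 + t ^ 2)⁻¹ ≤ D := fun t =>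
    mul_le_of_le_one_right hD (inv_le_one_of_one_le₀ (by nlinarith [sq_nonneg t]))
  have key : ∀ p q t v : ℝ, |p| ≤ C * (1 + t ^ 2)⁻¹ → |q| ≤ D * (1 + v ^ 2)⁻¹ →
      |p * q| ≤ C * D * (1 + t ^ 2)⁻¹ := by
    intro p q t v hp hq
    rw [abs_mul]
    calc |p| * |q| ≤ (C * (1 + t ^ 2)⁻¹) * D :=
          mul_le_mul hp (hq.trans (le1 v)) (abs_nonneg _) (by positivity)
      _ = _ := by ring
  refine nice_of_bound _ (fun x φ s => g' (x, φ + a * s) * h (x, φ + b * s) +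
      g (x, φ + a * s) * h' (x, φ + b * s)) a ha (2 * (C * D)) (fun x => by fun_prop)
    (fun x φ => by fun_prop) (fun x φ s => ?_) (fun x φ s => ?_) (fun x φ s => ?_)
  · exact (hasDerivAt_shift (f := fun u => g (x, u)) (gd x _)).mul
      (hasDerivAt_shift (f := fun u => h (x, u)) (hd x _))
  · refine (key _ _ _ _ (gb x _).1 (hb x _).1).trans ?_
    refine mul_le_mul_of_nonneg_right ?_ (by positivity)
    nlinarith [mul_nonneg hC hD]
  · refine (abs_add_le _ _).trans ?_
    have h1 := key _ _ _ _ (gb x (φ + a * s)).2 (hb x (φ + b * s)).1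
    have h2 := key _ _ _ _ (gb x (φ + a * s)).1 (hb x (φ + b * s)).2
    linarith

theorem nice_prod {d : ℕ} {g h : (Fin (d+1) → ℝ) × ℝ → ℝ} (hg : Decay2 d g)
    (hh : Decay2 d h) (a b : ℝ) (hab : a ≠ 0 ∨ b ≠ 0) :
    Nice (fun x φ s => g (x, φ + a * s) * h (x, φ + b * s)) := by
  rcases hab with ha | hb
  · exact nice_prod_left hg hh a b ha
  · have := nice_prod_left hh hg b a hb
    simpa only [mul_comm] using this

theorem dot_sum_smul {r l : Fin 3 → Fin 3 → ℝ}
    (hdual : ∀ i k, l i ⬝ᵥ r k = if i = k then (1 : ℝ) else 0) (c : Fin 3 → ℝ) (i : Fin 3) :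
    l i ⬝ᵥ (∑ k, c k • r k) = c i := by
  simp [dotProduct_sum, dotProduct_smul, hdual]

theorem typeF_decomp {d : ℕ} {ω : Fin 3 → ℝ} (hω : Function.Injective ω)
    {r l : Fin 3 → Fin 3 → ℝ}
    (hdual : ∀ i k, l i ⬝ᵥ r k = if i = k then (1 : ℝ) else 0)
    {F : (Fin (d+1) → ℝ) × ℝ × ℝ → Fin 3 → ℝ} (hF : IsTypeF d ω r F) (i : Fin 3) :
    ∃ (c : (Fin (d+1) → ℝ) → ℝ → ℝ) (N : (Fin (d+1) → ℝ) → ℝ → ℝ → ℝ), Nice N ∧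
      ∀ x θ ξ s, l i ⬝ᵥ F (x, θ + ω i * (ξ - s), s) = c x (θ + ω i * ξ) + N x (θ + ω i * ξ) s := by
  obtain ⟨f, g, h, hf, hg, hh, hF⟩ := hF
  refine ⟨fun x φ => f i i (x, φ) + g i i i (x, φ) * h i i i (x, φ),
    fun x φ s => (∑ k, if k = i then 0 else f i k (x, φ + (ω k - ω i) * s)) +
      ∑ lo, ∑ m, if lo ≤ m ∧ ¬ (lo = i ∧ m = i) then
        g i lo m (x, φ + (ω lo - ω i) * s) * h i lo m (x, φ + (ω m - ω i) * s) else 0, ?_, ?_⟩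
  · have hne : ∀ k, k ≠ i → ω k - ω i ≠ 0 := fun k hk => sub_ne_zero.2 (hω.ne hk)
    refine Nice.add (Nice.sum _ fun k => ?_) (Nice.sum _ fun lo => Nice.sum _ fun m => ?_)
    · by_cases hk : k = i
      · simpa only [hk, if_true] using Nice.zero
      · simpa only [hk, if_false] using nice_single (hf i k) _ (hne k hk)
    · by_cases hk : lo ≤ m ∧ ¬ (lo = i ∧ m = i)
      · simp only [hk, if_true, not_false_eq_true, and_self]
        refine nice_prod (hg i lo m) (hh i lo m) _ _ ?_
        by_cases hl : lo = i
        · exact Or.inr (hne m fun hm => hk.2 ⟨hl, hm⟩)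
        · exact Or.inl (hne lo hl)
      · simpa only [hk, if_false] using Nice.zero
  · intro x θ ξ s
    rw [hF, dot_sum_smul hdual]
    have e : ∀ k, θ + ω i * (ξ - s) + ω k * s = θ + ω i * ξ + (ω k - ω i) * s := fun k => by ring
    simp only [e]
    generalize θ + ω i * ξ = φ
    fin_cases i <;> simp [Fin.sum_univ_three] <;> ring

theorem const_zero {X : Type*} {N : X → ℝ → ℝ → ℝ} (hN : Nice N) (x : X) (φ c : ℝ)
    (h : Tendsto (fun S : ℝ => S⁻¹ * ∫ s in (0:ℝ)..S, (c + N x φ s)) atTop (𝓝 0)) : c = 0 := by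
  have hi := hN.int x φ
  have h0 : Tendsto (fun S : ℝ => S⁻¹ * ∫ s in (0:ℝ)..S, N x φ s) atTop (𝓝 0) := by
    have := intervalIntegral_tendsto_integral_Ioi (0:ℝ) hi.integrableOn tendsto_id
    simpa using tendsto_inv_atTop_zero.mul this
  have h1 : Tendsto (fun S : ℝ => S⁻¹ * ∫ s in (0:ℝ)..S, (c + N x φ s)) atTop (𝓝 (c + 0)) := by
    refine (h0.const_add c).congr' ?_
    filter_upwards [eventually_gt_atTop 0] with S hS
    rw [intervalIntegral.integral_add intervalIntegrable_const hi.intervalIntegrable]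
    simp only [intervalIntegral.integral_const, smul_eq_mul]
    field_simp
    ring
  simpa using tendsto_nhds_unique h1 h

theorem typeF_nice {d : ℕ} {ω : Fin 3 → ℝ} (hω : Function.Injective ω)
    {r l : Fin 3 → Fin 3 → ℝ}
    (hdual : ∀ i k, l i ⬝ᵥ r k = if i = k then (1 : ℝ) else 0)
    {F : (Fin (d+1) → ℝ) × ℝ × ℝ → Fin 3 → ℝ} (hF : IsTypeF d ω r F)
    (hE : EZero d ω l F) (i : Fin 3) :
    ∃ N : (Fin (d+1) → ℝ) → ℝ → ℝ → ℝ, Nice N ∧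
      ∀ x θ ξ s, l i ⬝ᵥ F (x, θ + ω i * (ξ - s), s) = N x (θ + ω i * ξ) s := by
  obtain ⟨c, N, hN, hc⟩ := typeF_decomp hω hdual hF i
  refine ⟨N, hN, fun x θ ξ s => ?_⟩
  have h := hE i x θ ξ
  simp only [hc] at h
  rw [hc, const_zero hN x _ _ h, zero_add]

/-- The moving-endpoint part. -/
theorem hasDerivAt_moving {G : ℝ → ℝ → ℝ} (hG : Continuous (fun p : ℝ × ℝ => G p.1 p.2))
    (p : ℝ → ℝ) (hp : Continuous p) (ξ : ℝ) :
    HasDerivAt (fun u => ∫ s in ξ..u, G (p u) s) (G (p ξ) ξ) ξ := by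
  rw [hasDerivAt_iff_isLittleO, Asymptotics.isLittleO_iff]
  intro ε hε
  have hc : ContinuousAt (fun q : ℝ × ℝ => G (p q.1) q.2) (ξ, ξ) :=
    (hG.comp ((hp.comp continuous_fst).prodMk continuous_snd)).continuousAt
  obtain ⟨η, hη, H⟩ := Metric.continuousAt_iff.1 hc ε hε
  filter_upwards [Metric.ball_mem_nhds ξ hη] with u hu
  have hcs : Continuous (G (p u)) := hG.comp (Continuous.prodMk_right (p u))
  have e : (∫ s in ξ..u, G (p u) s) - (∫ s in ξ..ξ, G (p ξ) s) - (u - ξ) • G (p ξ) ξ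
      = ∫ s in ξ..u, (G (p u) s - G (p ξ) ξ) := by
    rw [intervalIntegral.integral_sub (hcs.intervalIntegrable _ _) intervalIntegrable_const]
    simp
  rw [e]
  refine intervalIntegral.norm_integral_le_of_norm_le_const fun s hs => ?_
  have hs' : dist s ξ < η := by
    refine lt_of_le_of_lt ?_ hu
    rw [Real.dist_eq, Real.dist_eq]
    exact abs_sub_left_of_mem_uIcc (uIoc_subset_uIcc hs)
  have := @H (u, s) (by rw [Prod.dist_eq]; exact max_lt hu hs')
  rw [Real.dist_eq] at this
  exact this.le

theorem Nice.hasDerivAt_integral {X : Type*} {N : X → ℝ → ℝ → ℝ} (hN : Nice N) (x : X) (ξ : ℝ) :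
    ∃ K' : ℝ → ℝ, ∀ φ, HasDerivAt (fun u => ∫ s in Ici ξ, N x u s) (K' φ) φ := by
  obtain ⟨G', hd, hc, hb⟩ := hN.der
  refine ⟨fun φ => ∫ s in Ici ξ, G' x φ s, fun φ => ?_⟩
  obtain ⟨b, hbi, hbb⟩ := hb x φ
  exact (hasDerivAt_integral_of_dominated_loc_of_deriv_le
    (μ := volume.restrict (Ici ξ)) (F := fun u s => N x u s) (F' := fun u s => G' x u s)
    (bound := b) (Metric.ball_mem_nhds φ one_pos)
    (Eventually.of_forall fun u => (hN.int x u).aestronglyMeasurable.restrict)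
    (hN.int x φ).integrableOn (hc x φ).aestronglyMeasurable
    (Eventually.of_forall fun s u hu => hbb s u hu) hbi.integrableOn
    (Eventually.of_forall fun s u _ => hd x u s)).2

/-- **Proposition 1.9 (Proposition \ref{35}).**  If `F` is of type `ℱ` and `𝐄F = 0`, then the
integrals defining `𝐑_∞F` converge absolutely, `𝐑_∞F` is bounded on `{ξ_d ≥ 0}`, and
`L̃(∂_{θ₀},∂_{ξ_d})(𝐑_∞F) = F`.  Moreover, if in addition `F` is `C¹` and
`L̃(∂_{θ₀},∂_{ξ_d})F` is of type `ℱ`, then `𝐑_∞(L̃(∂_{θ₀},∂_{ξ_d})F) = F` as well. -/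
theorem Rinf_inverts_Ltilde
    (d : ℕ) (ω : Fin 3 → ℝ) (hω : Function.Injective ω)
    (r l : Fin 3 → Fin 3 → ℝ)
    (hdual : ∀ i k, l i ⬝ᵥ r k = if i = k then (1 : ℝ) else 0)
    (F : (Fin (d+1) → ℝ) × ℝ × ℝ → Fin 3 → ℝ)
    (hF : IsTypeF d ω r F) (hEF : EZero d ω l F) :
    (∀ (i : Fin 3) (x : Fin (d+1) → ℝ) (θ₀ ξd : ℝ), 0 ≤ ξd →
      IntegrableOn (fun s : ℝ => l i ⬝ᵥ F (x, θ₀ + ω i * (ξd - s), s)) (Ici ξd)) ∧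
    (∃ C : ℝ, ∀ (x : Fin (d+1) → ℝ) (θ₀ ξd : ℝ), 0 ≤ ξd →
      ‖Rinf3 d ω l r F (x, θ₀, ξd)‖ ≤ C) ∧
    SolvesLtilde d ω l (Rinf3 d ω l r F) F ∧
    (ContDiff ℝ 1 F → IsTypeF d ω r (LtildeTheta d ω l r F) →
      (∀ (i : Fin 3) (x : Fin (d+1) → ℝ) (θ₀ ξd : ℝ), 0 ≤ ξd →
        IntegrableOn
          (fun s : ℝ => l i ⬝ᵥ LtildeTheta d ω l r F (x, θ₀ + ω i * (ξd - s), s)) (Ici ξd)) ∧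
      ∀ (x : Fin (d+1) → ℝ) (θ₀ ξd : ℝ), 0 ≤ ξd →
        Rinf3 d ω l r (LtildeTheta d ω l r F) (x, θ₀, ξd) = F (x, θ₀, ξd)) := by
  choose N hN hNF using typeF_nice hω hdual hF hEF
  have hR : ∀ i x θ ξ, l i ⬝ᵥ Rinf3 d ω l r F (x, θ, ξ)
      = -∫ s in Ici ξ, N i x (θ + ω i * ξ) s := by
    intro i x θ ξ
    simp only [Rinf3, dotProduct_neg]
    rw [dot_sum_smul hdual]
    simp only [hNF]
  refine ⟨fun i x θ ξ _ => ?_, ?_, ?_, ?_⟩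
  · simp only [hNF]
    exact ((hN i).int _ _).integrableOn
  · choose C hC using fun i => (hN i).bdd
    refine ⟨∑ i, C i * ‖r i‖, fun x θ ξ _ => ?_⟩
    simp only [Rinf3, norm_neg]
    refine norm_sum_le_of_le _ fun i _ => ?_
    rw [norm_smul]
    refine mul_le_mul_of_nonneg_right ?_ (norm_nonneg _)
    simp only [hNF]
    refine (norm_integral_le_integral_norm _).trans (le_trans ?_ (hC i x (θ + ω i * ξ)))
    exact setIntegral_le_integral ((hN i).int _ _).norm
      (Eventually.of_forall fun s => norm_nonneg _)
  · intro i x θ ξ _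
    obtain ⟨K', hK⟩ := (hN i).hasDerivAt_integral x ξ
    simp only [hR]
    refine ⟨-K' (θ + ω i * ξ), -(K' (θ + ω i * ξ) * ω i - N i x (θ + ω i * ξ) ξ),
      ?_, ?_, ?_⟩
    · exact (hasDerivAt_shift (hK (θ + ω i * ξ))).neg
    · have hp : HasDerivAt (fun u => θ + ω i * u) (ω i) ξ := by
        simpa using ((hasDerivAt_id ξ).const_mul (ω i)).const_add θ
      have h1 : HasDerivAt (fun u => ∫ s in Ici ξ, N i x (θ + ω i * u) s)
          (K' (θ + ω i * ξ) * ω i) ξ :=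
        HasDerivAt.comp (h₂ := fun v => ∫ s in Ici ξ, N i x v s) ξ (hK (θ + ω i * ξ)) hp
      have h2 := hasDerivAt_moving ((hN i).cont x) (fun u => θ + ω i * u) (by fun_prop) ξ
      refine (h1.sub h2).neg.congr_of_eventuallyEq (Eventually.of_forall fun u => ?_)
      have hi := (hN i).int x (θ + ω i * u)
      simp only [Pi.neg_apply, Pi.sub_apply, integral_Ici_eq_integral_Ioi]
      rw [← intervalIntegral.integral_Ioi_sub_Ioi' hi.integrableOn hi.integrableOn]
      ring
    · have := hNF i x θ ξ ξ
      rw [sub_self, mul_zero, add_zero] at this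
      rw [this]
      ring
  · intro hC1 hL
    have hder : ∀ i x θ ξ s, HasDerivAt (fun s => N i x (θ + ω i * ξ) s)
        (l i ⬝ᵥ LtildeTheta d ω l r F (x, θ + ω i * (ξ - s), s)) s := by
      intro i x θ ξ s
      have hdiff : Differentiable ℝ (fun q : ℝ × ℝ => l i ⬝ᵥ F (x, q.1, q.2)) := by
        have h1 : Differentiable ℝ F := hC1.differentiable one_ne_zero
        have h2 : Differentiable ℝ (fun q : ℝ × ℝ => F (x, q.1, q.2)) :=
          h1.comp (by fun_prop)
        have h3 := differentiable_pi.1 h2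
        simp only [dotProduct]
        fun_prop
      have h1 := (hdiff (θ + ω i * (ξ - s), s)).hasFDerivAt
      have h2 : HasDerivAt (fun s : ℝ => (θ + ω i * (ξ - s), s)) (-ω i, (1:ℝ)) s := by
        refine HasDerivAt.prodMk ?_ (hasDerivAt_id s)
        simpa using (((hasDerivAt_id s).const_sub ξ).const_mul (ω i)).const_add θ
      have h3 := HasFDerivAt.comp_hasDerivAt (f := fun s : ℝ => (θ + ω i * (ξ - s), s)) s h1 h2
      simp only [LtildeTheta]
      rw [dot_sum_smul hdual]
      have h4 : ((-ω i, (1:ℝ)) : ℝ × ℝ) = (0, 1) - ω i • ((1:ℝ), (0:ℝ)) := by simp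
      rw [h4, map_sub, map_smul, smul_eq_mul] at h3
      refine h3.congr_of_eventuallyEq (Eventually.of_forall fun u => ?_)
      exact (hNF i x θ ξ u).symm
    have hcont : ∀ i x θ ξ, Continuous
        (fun s => l i ⬝ᵥ LtildeTheta d ω l r F (x, θ + ω i * (ξ - s), s)) := by
      intro i x θ ξ
      obtain ⟨c, M, hM, hc⟩ := typeF_decomp hω hdual hL i
      simp only [hc]
      exact continuous_const.add ((hM.cont x).comp (Continuous.prodMk_right _))
    have hEL : EZero d ω l (LtildeTheta d ω l r F) := by
      intro i x θ ξ
      have e : ∀ S : ℝ, ∫ s in (0:ℝ)..S,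
          l i ⬝ᵥ LtildeTheta d ω l r F (x, θ + ω i * (ξ - s), s)
          = N i x (θ + ω i * ξ) S - N i x (θ + ω i * ξ) 0 := fun S =>
        intervalIntegral.integral_eq_sub_of_hasDerivAt (fun s _ => hder i x θ ξ s)
          ((hcont i x θ ξ).intervalIntegrable _ _)
      simp only [e]
      simpa using tendsto_inv_atTop_zero.mul
        (((hN i).tend x (θ + ω i * ξ)).sub_const (N i x (θ + ω i * ξ) 0))
    have hInt : ∀ i x θ ξ, Integrable
        (fun s => l i ⬝ᵥ LtildeTheta d ω l r F (x, θ + ω i * (ξ - s), s)) := by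
      intro i x θ ξ
      obtain ⟨M, hM, hc⟩ := typeF_nice hω hdual hL hEL i
      simp only [hc]
      exact hM.int _ _
    refine ⟨fun i x θ ξ _ => (hInt i x θ ξ).integrableOn, fun x θ ξ _ => ?_⟩
    have hFr : F (x, θ, ξ) = ∑ i, (l i ⬝ᵥ F (x, θ, ξ)) • r i := by
      obtain ⟨f, g, h, -, -, -, hf⟩ := hF
      conv_rhs => rw [hf]
      simp only [dot_sum_smul hdual]
      exact hf x θ ξ
    rw [hFr]
    simp only [Rinf3]
    rw [← Finset.sum_neg_distrib]
    refine Finset.sum_congr rfl fun i _ => ?_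
    rw [← neg_smul]
    congr 1
    rw [integral_Ici_eq_integral_Ioi, integral_Ioi_of_hasDerivAt_of_tendsto'
      (fun s _ => hder i x θ ξ s) (hInt i x θ ξ).integrableOn ((hN i).tend x _)]
    have := hNF i x θ ξ ξ
    rw [sub_self, mul_zero, add_zero] at this
    rw [this]
    ring

end
end

section
/- Let F(x,θ₀,ξ_d) be of type ℱ. (a) The equation L̃(∂_{θ₀},∂_{ξ_d})𝒰 = F has a C¹ solution 𝒰 bounded in (θ₀,ξ_d) if and only if 𝐄F = 0. (b) When 𝐄F = 0, every C¹ solution bounded in (θ₀,ξ_d) has the form 𝒰 = Σ_{i=1}^3 τ_i(x,θ₀+ω_iξ_d) r_i + 𝐑_∞F with each τ_i(x,θ) C¹ and bounded; moreover 𝐄𝒰 = Σ_{i=1}^3 τ_i(x,θ₀+ω_iξ_d) r_i and (I−𝐄)𝒰 = 𝐑_∞F. (c) If 𝒰 is of type ℱ and C¹ with L̃(∂_{θ₀},∂_{ξ_d})𝒰 of type ℱ, then 𝐄(L̃(∂_{θ₀},∂_{ξ_d})𝒰) = L̃(∂_{θ₀},∂_{ξ_d})(𝐄𝒰) = 0.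 -/
open MeasureTheory Filter Set Matrix
open scoped ENNReal Topology

noncomputable section


/-- `C¹` functions with integrable decay along the direction `v`. -/
def GoodAlong {E : Type*} [NormedAddCommGroup E] [NormedSpace ℝ E] (v : E) (φ : E → ℝ) : Prop :=
  ContDiff ℝ 1 φ ∧
  (∀ R : ℝ, ∃ C : ℝ, ∀ (p : E) (t : ℝ), ‖p‖ ≤ R →
    |φ (p + t • v)| ≤ C * (1 + t ^ 2)⁻¹ ∧ ‖fderiv ℝ φ (p + t • v)‖ ≤ C * (1 + t ^ 2)⁻¹) ∧
  (∃ C : ℝ, ∀ p : E, ∫ t : ℝ, |φ (p + t • v)| ≤ C)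

/-- Integral along the half-line in direction `v`. -/
def halfInt {E : Type*} [NormedAddCommGroup E] [NormedSpace ℝ E] (v : E) (φ : E → ℝ) (p : E) : ℝ :=
  ∫ t in Ioi (0 : ℝ), φ (p + t • v)

section general
variable {E : Type*} [NormedAddCommGroup E] [NormedSpace ℝ E] {v : E} {φ ψ : E → ℝ}

lemma GoodAlong.cont_line (h : GoodAlong v φ) (p : E) : Continuous (fun t : ℝ => φ (p + t • v)) :=
  h.1.continuous.comp (by fun_prop)

lemma GoodAlong.integrable (h : GoodAlong v φ) (p : E) : Integrable (fun t : ℝ => φ (p + t • v)) := by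
  obtain ⟨C, hC⟩ := h.2.1 ‖p‖
  refine (integrable_inv_one_add_sq.const_mul C).mono' (h.cont_line p).aestronglyMeasurable ?_
  exact Eventually.of_forall fun t => (hC p t le_rfl).1

lemma GoodAlong.zero : GoodAlong v (fun _ : E => (0 : ℝ)) := by
  refine ⟨contDiff_const, fun R => ⟨0, fun p t _ => ?_⟩, 0, fun p => ?_⟩
  · simp
  · simp

lemma GoodAlong.add (h : GoodAlong v φ) (h' : GoodAlong v ψ) :
    GoodAlong v (fun p => φ p + ψ p) := by
  refine ⟨h.1.add h'.1, fun R => ?_, ?_⟩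
  · obtain ⟨C, hC⟩ := h.2.1 R
    obtain ⟨C', hC'⟩ := h'.2.1 R
    refine ⟨C + C', fun p t hp => ⟨?_, ?_⟩⟩
    · rw [add_mul]
      exact (abs_add_le _ _).trans (add_le_add (hC p t hp).1 (hC' p t hp).1)
    · rw [add_mul, fderiv_fun_add (h.1.differentiable (by norm_num) _)
        (h'.1.differentiable (by norm_num) _)]
      exact (norm_add_le _ _).trans (add_le_add (hC p t hp).2 (hC' p t hp).2)
  · obtain ⟨C, hC⟩ := h.2.2
    obtain ⟨C', hC'⟩ := h'.2.2
    refine ⟨C + C', fun p => ?_⟩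
    refine le_trans ?_ (add_le_add (hC p) (hC' p))
    rw [← integral_add (h.integrable p).abs (h'.integrable p).abs]
    exact integral_mono ((h.integrable p).add (h'.integrable p)).abs
      ((h.integrable p).abs.add (h'.integrable p).abs) (fun t => abs_add_le _ _)

lemma GoodAlong.sum {ι : Type*} (s : Finset ι) {φ : ι → E → ℝ} (h : ∀ i ∈ s, GoodAlong v (φ i)) :
    GoodAlong v (fun p => ∑ i ∈ s, φ i p) := by
  classical
  induction s using Finset.induction_on with
  | empty => simpa using GoodAlong.zero
  | insert a s ha ih =>
    simp only [Finset.sum_insert ha]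
    exact (h a (by simp)).add (ih fun i hi => h i (by simp [hi]))

lemma GoodAlong.mul_bdd (h : GoodAlong v φ) (hψ : ContDiff ℝ 1 ψ) {M : ℝ}
    (hM : ∀ p, |ψ p| ≤ M ∧ ‖fderiv ℝ ψ p‖ ≤ M) : GoodAlong v (fun p => φ p * ψ p) := by
  have hM0 : 0 ≤ M := (abs_nonneg _).trans (hM 0).1
  refine ⟨h.1.mul hψ, fun R => ?_, ?_⟩
  · obtain ⟨C, hC⟩ := h.2.1 R
    refine ⟨C * M + C * M, fun p t hp => ⟨?_, ?_⟩⟩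
    · have h1 := mul_le_mul (hC p t hp).1 (hM (p + t • v)).1 (abs_nonneg _)
        ((abs_nonneg _).trans (hC p t hp).1)
      have h2 := (mul_nonneg (abs_nonneg _) (abs_nonneg _)).trans h1
      rw [abs_mul]
      nlinarith
    · rw [fderiv_fun_mul (h.1.differentiable (by norm_num) _)
        (hψ.differentiable (by norm_num) _)]
      refine (norm_add_le _ _).trans ?_
      rw [norm_smul, norm_smul, Real.norm_eq_abs, Real.norm_eq_abs]
      have h1 := mul_le_mul (hC p t hp).1 (hM (p + t • v)).2 (norm_nonneg _)
        ((abs_nonneg _).trans (hC p t hp).1)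
      have h2 := mul_le_mul (hM (p + t • v)).1 (hC p t hp).2 (norm_nonneg _) hM0
      nlinarith
  · obtain ⟨C, hC⟩ := h.2.2
    refine ⟨C * M, fun p => ?_⟩
    refine le_trans ?_ (mul_le_mul_of_nonneg_right (hC p) hM0)
    rw [← integral_mul_const]
    refine integral_mono_of_nonneg (Eventually.of_forall fun t => abs_nonneg _)
      ((h.integrable p).abs.mul_const M) (Eventually.of_forall fun t => ?_)
    simp only [abs_mul]
    exact mul_le_mul_of_nonneg_left (hM _).1 (abs_nonneg _)

lemma GoodAlong.halfInt_contDiff (h : GoodAlong v φ) : ContDiff ℝ 1 (halfInt v φ) := by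
  have hfc : Continuous (fderiv ℝ φ) := h.1.continuous_fderiv (by norm_num)
  have hd : ∀ p, HasFDerivAt (halfInt v φ) (∫ t in Ioi (0:ℝ), fderiv ℝ φ (p + t • v)) p := by
    intro p
    obtain ⟨C, hC⟩ := h.2.1 (‖p‖ + 1)
    refine hasFDerivAt_integral_of_dominated_of_fderiv_le (s := Metric.ball p 1)
      (F := fun q t => φ (q + t • v)) (F' := fun q t => fderiv ℝ φ (q + t • v))
      (bound := fun t => C * (1 + t ^ 2)⁻¹) (Metric.ball_mem_nhds p one_pos) ?_ ?_ ?_ ?_ ?_ ?_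
    · exact Eventually.of_forall fun q => (h.cont_line q).aestronglyMeasurable
    · exact (h.integrable p).integrableOn
    · exact (hfc.comp (by fun_prop : Continuous fun t : ℝ => p + t • v)).aestronglyMeasurable
    · refine Eventually.of_forall fun t q hq => (hC q t ?_).2
      have : ‖q‖ ≤ ‖p‖ + ‖q - p‖ := by simpa using norm_add_le p (q - p)
      rw [Metric.mem_ball, dist_eq_norm] at hq
      linarith
    · exact (integrable_inv_one_add_sq.const_mul C).integrableOn
    · refine Eventually.of_forall fun t q hq => ?_
      exact (hasFDerivAt_comp_add_right (t • v)).2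
        (h.1.differentiable (by norm_num) (q + t • v)).hasFDerivAt
  rw [contDiff_one_iff_fderiv]
  refine ⟨fun p => (hd p).differentiableAt, ?_⟩
  have : fderiv ℝ (halfInt v φ) = fun p => ∫ t in Ioi (0:ℝ), fderiv ℝ φ (p + t • v) :=
    funext fun p => (hd p).fderiv
  rw [this, continuous_iff_continuousAt]
  intro p
  obtain ⟨C, hC⟩ := h.2.1 (‖p‖ + 1)
  refine continuousAt_of_dominated (bound := fun t => C * (1 + t ^ 2)⁻¹) ?_ ?_ ?_ ?_
  · exact Eventually.of_forall fun q =>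
      (hfc.comp (by fun_prop : Continuous fun t : ℝ => q + t • v)).aestronglyMeasurable
  · filter_upwards [Metric.ball_mem_nhds p one_pos] with q hq
    refine Eventually.of_forall fun t => (hC q t ?_).2
    have : ‖q‖ ≤ ‖p‖ + ‖q - p‖ := by simpa using norm_add_le p (q - p)
    rw [Metric.mem_ball, dist_eq_norm] at hq
    linarith
  · exact (integrable_inv_one_add_sq.const_mul C).integrableOn
  · exact Eventually.of_forall fun t => (hfc.comp (by fun_prop)).continuousAt

lemma GoodAlong.halfInt_bdd (h : GoodAlong v φ) : ∃ C, ∀ p, |halfInt v φ p| ≤ C := by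
  obtain ⟨C, hC⟩ := h.2.2
  refine ⟨C, fun p => le_trans ?_ (hC p)⟩
  refine (abs_integral_le_integral_abs).trans ?_
  exact setIntegral_le_integral (h.integrable p).abs (Eventually.of_forall fun t => abs_nonneg _)

lemma halfInt_shift (v : E) (φ : E → ℝ) (p : E) (a : ℝ) :
    halfInt v φ (p + a • v) = ∫ t in Ioi a, φ (p + t • v) := by
  have := (measurePreserving_add_right (volume : Measure ℝ) a).setIntegral_preimage_emb
    (measurableEmbedding_addRight a) (fun t => φ (p + t • v)) (Ioi a)
  rw [← this]
  simp only [halfInt]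
  have h2 : (fun x => x + a) ⁻¹' Ioi a = Ioi 0 := by ext; simp
  rw [h2]
  congr 1
  ext t
  congr 1
  module

lemma GoodAlong.halfInt_line (h : GoodAlong v φ) (p : E) (a : ℝ) :
    halfInt v φ (p + a • v) = halfInt v φ p - ∫ t in (0:ℝ)..a, φ (p + t • v) := by
  rw [halfInt_shift, halfInt, ← intervalIntegral.integral_Ioi_sub_Ioi' (h.integrable p).integrableOn
    (h.integrable p).integrableOn]
  ring

lemma GoodAlong.halfInt_tendsto (h : GoodAlong v φ) (p : E) :
    Tendsto (fun a : ℝ => halfInt v φ (p + a • v)) atTop (𝓝 0) := by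
  have := intervalIntegral_tendsto_integral_Ioi 0 (h.integrable p).integrableOn tendsto_id
  have h2 := (tendsto_const_nhds (x := halfInt v φ p)).sub this
  simp only [halfInt, sub_self] at h2
  refine h2.congr fun a => ?_
  rw [h.halfInt_line]; rfl

lemma GoodAlong.halfInt_fderiv (h : GoodAlong v φ) (p : E) :
    fderiv ℝ (halfInt v φ) p v = - φ p := by
  have h1 : HasDerivAt (fun a : ℝ => halfInt v φ (p + a • v)) (fderiv ℝ (halfInt v φ) p v) 0 := by
    have hl : HasDerivAt (fun a : ℝ => p + a • v) v 0 := by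
      simpa using ((hasDerivAt_id (0:ℝ)).smul_const v).const_add p
    have h0 : HasFDerivAt (halfInt v φ) (fderiv ℝ (halfInt v φ) p) (p + (0:ℝ) • v) := by
      simpa using (h.halfInt_contDiff.differentiable (by norm_num) p).hasFDerivAt
    exact HasFDerivAt.comp_hasDerivAt (0:ℝ) h0 hl
  have h2 : HasDerivAt (fun a : ℝ => halfInt v φ (p + a • v)) (- φ p) 0 := by
    have := (((h.cont_line p).integral_hasStrictDerivAt 0 0).hasDerivAt).const_sub (halfInt v φ p)
    simp only [zero_smul, add_zero] at this
    refine this.congr_of_eventuallyEq (Eventually.of_forall fun a => ?_)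
    exact h.halfInt_line p a
  exact h1.unique h2

lemma avg_zero_of_bdd {I : ℝ → ℝ} {C : ℝ} (h : ∀ S, 0 ≤ S → |I S| ≤ C) :
    Tendsto (fun S : ℝ => S⁻¹ * I S) atTop (𝓝 0) := by
  refine squeeze_zero_norm' (a := fun S => S⁻¹ * C) ?_ ?_
  · filter_upwards [eventually_gt_atTop 0] with S hS
    rw [norm_mul, Real.norm_of_nonneg (inv_nonneg.2 hS.le), Real.norm_eq_abs]
    exact mul_le_mul_of_nonneg_left (h S hS.le) (inv_nonneg.2 hS.le)
  · simpa using tendsto_inv_atTop_zero.mul_const C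

lemma GoodAlong.avg_zero (h : GoodAlong v φ) (p : E) :
    Tendsto (fun S : ℝ => S⁻¹ * ∫ t in (0:ℝ)..S, φ (p + t • v)) atTop (𝓝 0) := by
  obtain ⟨C, hC⟩ := h.halfInt_bdd
  refine avg_zero_of_bdd (C := C + C) fun S _ => ?_
  have := h.halfInt_line p S
  have h1 : ∫ t in (0:ℝ)..S, φ (p + t • v) = halfInt v φ p - halfInt v φ (p + S • v) := by linarith
  rw [h1]
  exact (abs_sub _ _).trans (add_le_add (hC _) (hC _))

lemma avg_const_add {I : ℝ → ℝ} (hI : Continuous I) {c L : ℝ}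
    (h : Tendsto (fun S : ℝ => S⁻¹ * ∫ t in (0:ℝ)..S, I t) atTop (𝓝 L)) :
    Tendsto (fun S : ℝ => S⁻¹ * ∫ t in (0:ℝ)..S, (c + I t)) atTop (𝓝 (c + L)) := by
  refine (h.const_add c).congr' ?_
  filter_upwards [eventually_gt_atTop 0] with S hS
  rw [intervalIntegral.integral_add (by simp) (hI.intervalIntegrable _ _)]
  simp
  field_simp

lemma avg_zero_of_tendsto {I : ℝ → ℝ} (hI : Continuous I) (h : Tendsto I atTop (𝓝 0)) :
    Tendsto (fun S : ℝ => S⁻¹ * ∫ t in (0:ℝ)..S, I t) atTop (𝓝 0) := by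
  rw [Metric.tendsto_atTop]
  intro ε hε
  obtain ⟨N, hN⟩ := (Metric.tendsto_atTop.1 h) (ε / 2) (half_pos hε)
  set M := max N 1 with hMdef
  set K := |∫ t in (0:ℝ)..M, I t| with hK
  have hK0 : 0 ≤ K := abs_nonneg _
  refine ⟨max M (2 * K / ε + 1), fun S hS => ?_⟩
  have hSM : M ≤ S := (le_max_left _ _).trans hS
  have hSK : 2 * K / ε + 1 ≤ S := (le_max_right _ _).trans hS
  have hM1 : 1 ≤ M := le_max_right _ _
  have hS0 : 0 < S := by linarith
  have h2 : ‖∫ t in M..S, I t‖ ≤ ε / 2 * |S - M| := by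
    refine intervalIntegral.norm_integral_le_of_norm_le_const fun t ht => ?_
    rw [uIoc_of_le hSM] at ht
    have := hN t ((le_max_left _ _).trans ht.1.le)
    rw [dist_zero_right] at this
    exact this.le
  rw [abs_of_nonneg (sub_nonneg.2 hSM), Real.norm_eq_abs] at h2
  have h3 := intervalIntegral.integral_add_adjacent_intervals (hI.intervalIntegrable 0 M)
    (hI.intervalIntegrable M S) (μ := volume)
  rw [dist_zero_right, norm_mul, Real.norm_of_nonneg (inv_nonneg.2 hS0.le), ← h3,
    inv_mul_lt_iff₀ hS0]
  have h4 : 2 * K / ε < S := by linarith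
  rw [div_lt_iff₀ hε] at h4
  have h5 := abs_add_le (∫ t in (0:ℝ)..M, I t) (∫ t in M..S, I t)
  rw [Real.norm_eq_abs]
  nlinarith

end general

section special
variable {d : ℕ}

lemma Decay2.bdd {f : (Fin (d+1) → ℝ) × ℝ → ℝ} (hf : Decay2 d f) :
    ∃ C : ℝ, 0 ≤ C ∧ ∀ q, |f q| ≤ C * (1 + q.2 ^ 2)⁻¹ ∧
      ‖fderiv ℝ f q‖ ≤ C * (1 + q.2 ^ 2)⁻¹ ∧ |f q| ≤ C ∧ ‖fderiv ℝ f q‖ ≤ C := by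
  obtain ⟨C, hC⟩ := hf.2
  have key : ∀ y θ : ℝ, 0 ≤ y → (1 + θ ^ 2) * y ≤ C → y ≤ C * (1 + θ ^ 2)⁻¹ ∧ y ≤ C := by
    intro y θ hy h
    have h1 : 0 < 1 + θ ^ 2 := by positivity
    refine ⟨?_, ?_⟩
    · rw [← div_eq_mul_inv, le_div_iff₀ h1]; linarith
    · nlinarith [mul_nonneg (sq_nonneg θ) hy]
  refine ⟨C, ?_, ?_⟩
  · exact (abs_nonneg _).trans (key _ _ (abs_nonneg _) (hC 0 0).1).2
  · rintro ⟨x, θ⟩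
    have h1 := key _ _ (abs_nonneg _) (hC x θ).1
    have h2 := key _ _ (norm_nonneg _) (hC x θ).2
    exact ⟨h1.1, h2.1, h1.2, h2.2⟩

/-- The projection `(x, θ, ξ) ↦ (x, θ + a ξ)`. -/
def projA (d : ℕ) (a : ℝ) : ((Fin (d+1) → ℝ) × ℝ × ℝ) →L[ℝ] ((Fin (d+1) → ℝ) × ℝ) :=
  (ContinuousLinearMap.fst ℝ _ _).prod
    ((ContinuousLinearMap.fst ℝ ℝ ℝ + a • ContinuousLinearMap.snd ℝ ℝ ℝ).comp
      (ContinuousLinearMap.snd ℝ _ _))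

lemma projA_apply (a : ℝ) (p : (Fin (d+1) → ℝ) × ℝ × ℝ) :
    projA d a p = (p.1, p.2.1 + a * p.2.2) := by
  simp [projA]

lemma Decay2.fderiv_comp {f : (Fin (d+1) → ℝ) × ℝ → ℝ} (hf : Decay2 d f) (a : ℝ)
    (p : (Fin (d+1) → ℝ) × ℝ × ℝ) :
    ‖fderiv ℝ (fun p : (Fin (d+1) → ℝ) × ℝ × ℝ => f (projA d a p)) p‖
      ≤ ‖fderiv ℝ f (projA d a p)‖ * ‖projA d a‖ := by
  have h := (hf.1.differentiable (by norm_num) (projA d a p)).hasFDerivAt.comp p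
    (projA d a).hasFDerivAt
  have h2 : fderiv ℝ (fun p : (Fin (d+1) → ℝ) × ℝ × ℝ => f (projA d a p)) p
    = (fderiv ℝ f (projA d a p)).comp (projA d a) := h.fderiv
  rw [h2]
  exact ContinuousLinearMap.opNorm_comp_le _ _

lemma Decay2.contDiff_comp {f : (Fin (d+1) → ℝ) × ℝ → ℝ} (hf : Decay2 d f) (a : ℝ) :
    ContDiff ℝ 1 (fun p : (Fin (d+1) → ℝ) × ℝ × ℝ => f (projA d a p)) :=
  hf.1.comp (projA d a).contDiff

lemma Decay2.comp_bdd {f : (Fin (d+1) → ℝ) × ℝ → ℝ} (hf : Decay2 d f) (a : ℝ) :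
    ∃ M, ∀ p, |f (projA d a p)| ≤ M ∧
      ‖fderiv ℝ (fun p : (Fin (d+1) → ℝ) × ℝ × ℝ => f (projA d a p)) p‖ ≤ M := by
  obtain ⟨C, hC0, hC⟩ := hf.bdd
  refine ⟨C + C * ‖projA d a‖, fun p => ⟨?_, ?_⟩⟩
  · have := (hC (projA d a p)).2.2.1
    have : 0 ≤ C * ‖projA d a‖ := by positivity
    linarith
  · refine (hf.fderiv_comp a p).trans ?_
    have := mul_le_mul_of_nonneg_right (hC (projA d a p)).2.2.2 (norm_nonneg (projA d a))
    linarith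

lemma peetre (c y t : ℝ) (hc : c ≠ 0) :
    (1 + (y + t * c) ^ 2)⁻¹ ≤ (1 + (c ^ 2)⁻¹) * (2 * (1 + y ^ 2)) * (1 + t ^ 2)⁻¹ := by
  have h1 : 0 < 1 + (y + t * c) ^ 2 := by positivity
  have h2 : 0 < 1 + t ^ 2 := by positivity
  have hc2 : 0 < c ^ 2 := by positivity
  rw [← div_eq_mul_inv, le_div_iff₀ h2, inv_mul_le_iff₀ h1]
  have h3 : 1 + c ^ 2 * t ^ 2 ≤ 2 * (1 + y ^ 2) * (1 + (y + t * c) ^ 2) := by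
    nlinarith [sq_nonneg (y + (y + t * c)), mul_nonneg (sq_nonneg y) (sq_nonneg (y + t * c)),
      sq_nonneg y, sq_nonneg (y + t * c)]
  have h4 : 1 + t ^ 2 ≤ (1 + (c ^ 2)⁻¹) * (1 + c ^ 2 * t ^ 2) := by
    have : (c ^ 2)⁻¹ * c ^ 2 = 1 := inv_mul_cancel₀ hc2.ne'
    have h5 : (1 + (c ^ 2)⁻¹) * (1 + c ^ 2 * t ^ 2) =
      1 + c ^ 2 * t ^ 2 + (c ^ 2)⁻¹ + ((c ^ 2)⁻¹ * c ^ 2) * t ^ 2 := by ring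
    rw [h5, this]
    have : 0 ≤ c ^ 2 * t ^ 2 := by positivity
    have : 0 ≤ (c ^ 2)⁻¹ := by positivity
    linarith
  refine h4.trans ?_
  have := mul_le_mul_of_nonneg_left h3 (by positivity : 0 ≤ 1 + (c ^ 2)⁻¹)
  linarith

lemma projA_line (a b t : ℝ) (p : (Fin (d+1) → ℝ) × ℝ × ℝ) :
    projA d a (p + t • ((0, -b, 1) : (Fin (d+1) → ℝ) × ℝ × ℝ)) =
      (p.1, (projA d a p).2 + t * (a - b)) := by
  rw [projA_apply, projA_apply]
  ext <;> simp
  ring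

lemma Decay2.good {f : (Fin (d+1) → ℝ) × ℝ → ℝ} (hf : Decay2 d f) {a b : ℝ} (hab : a ≠ b) :
    GoodAlong ((0, -b, 1) : (Fin (d+1) → ℝ) × ℝ × ℝ) (fun p => f (projA d a p)) := by
  obtain ⟨C, hC0, hC⟩ := hf.bdd
  have hc : a - b ≠ 0 := sub_ne_zero.2 hab
  have hcd := hf.contDiff_comp a
  refine ⟨hcd, fun R => ?_, ?_⟩
  · set P := ‖projA d a‖ with hP
    have hP0 : 0 ≤ P := norm_nonneg _
    set K := (1 + ((a - b) ^ 2)⁻¹) * (2 * (1 + (P * R) ^ 2)) with hK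
    have hK0 : 0 ≤ K := by positivity
    refine ⟨C * K + C * K * P, fun p t hp => ?_⟩
    have hy : |(projA d a p).2| ≤ P * R :=
      (norm_snd_le (projA d a p)).trans (((projA d a).le_opNorm p).trans
        (mul_le_mul_of_nonneg_left hp hP0))
    have hbd : (1 + ((projA d a (p + t • ((0, -b, 1) : (Fin (d+1) → ℝ) × ℝ × ℝ))).2) ^ 2)⁻¹
        ≤ K * (1 + t ^ 2)⁻¹ := by
      rw [projA_line]
      refine (peetre _ _ _ hc).trans ?_
      have : (projA d a p).2 ^ 2 ≤ (P * R) ^ 2 := by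
        rw [← sq_abs]; exact pow_le_pow_left₀ (abs_nonneg _) hy 2
      rw [hK]; gcongr
    have ht : 0 ≤ (1 + t ^ 2)⁻¹ := by positivity
    have h1 := mul_le_mul_of_nonneg_left hbd hC0
    obtain ⟨e1, e2, -, -⟩ := hC (projA d a (p + t • ((0, -b, 1) : (Fin (d+1) → ℝ) × ℝ × ℝ)))
    have n1 : 0 ≤ C * K * P * (1 + t ^ 2)⁻¹ := by positivity
    have n2 : 0 ≤ C * K * (1 + t ^ 2)⁻¹ := by positivity
    refine ⟨?_, ?_⟩
    · nlinarith
    · refine (hf.fderiv_comp a _).trans ?_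
      have h2 := mul_le_mul_of_nonneg_right (e2.trans h1) hP0
      nlinarith
  · refine ⟨C * (|(a - b)⁻¹| * Real.pi), fun p => ?_⟩
    set y := (projA d a p).2 with hy
    have hint : Integrable (fun t : ℝ => (1 + (y + (a - b) * t) ^ 2)⁻¹) :=
      (integrable_inv_one_add_sq.comp_add_left y).comp_mul_left' hc
    have hval : ∫ t : ℝ, (1 + (y + (a - b) * t) ^ 2)⁻¹ = |(a - b)⁻¹| * Real.pi := by
      rw [Measure.integral_comp_mul_left (fun u : ℝ => (1 + (y + u) ^ 2)⁻¹),
        integral_add_left_eq_self (fun u : ℝ => (1 + u ^ 2)⁻¹), integral_univ_inv_one_add_sq]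
      rfl
    rw [← hval, ← integral_const_mul]
    refine integral_mono_of_nonneg (Eventually.of_forall fun t => abs_nonneg _)
      (hint.const_mul C) (Eventually.of_forall fun t => ?_)
    have := (hC (projA d a (p + t • ((0, -b, 1) : (Fin (d+1) → ℝ) × ℝ × ℝ)))).1
    rw [projA_line] at this
    simp only [projA_line]
    rwa [mul_comm (a - b) t]

lemma dot_sum (l r : Fin 3 → Fin 3 → ℝ)
    (hdual : ∀ i k, l i ⬝ᵥ r k = if i = k then (1 : ℝ) else 0) (c : Fin 3 → ℝ) (j : Fin 3) :
    l j ⬝ᵥ (∑ i : Fin 3, c i • r i) = c j := by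
  rw [dotProduct_sum]
  simp [dotProduct_smul, hdual]

lemma expand (l r : Fin 3 → Fin 3 → ℝ)
    (hdual : ∀ i k, l i ⬝ᵥ r k = if i = k then (1 : ℝ) else 0) (u : Fin 3 → ℝ) :
    u = ∑ i : Fin 3, (l i ⬝ᵥ u) • r i := by
  have h1 : (Matrix.of l) * (Matrix.of r)ᵀ = 1 := by
    ext i k
    rw [Matrix.mul_apply, Matrix.one_apply, ← hdual i k]
    rfl
  have h2 : (Matrix.of r)ᵀ * (Matrix.of l) = 1 := mul_eq_one_comm.1 h1
  have h3 : ((Matrix.of r)ᵀ * (Matrix.of l)) *ᵥ u = u := by rw [h2, Matrix.one_mulVec]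
  rw [← Matrix.mulVec_mulVec] at h3
  conv_lhs => rw [← h3]
  ext k
  simp [Matrix.mulVec, dotProduct, Finset.sum_apply, Matrix.of_apply, mul_comm]

lemma decomp (ω : Fin 3 → ℝ) (hω : Function.Injective ω) (r l : Fin 3 → Fin 3 → ℝ)
    (hdual : ∀ i k, l i ⬝ᵥ r k = if i = k then (1 : ℝ) else 0)
    (F : (Fin (d+1) → ℝ) × ℝ × ℝ → Fin 3 → ℝ) (hF : IsTypeF d ω r F) (j : Fin 3) :
    ∃ (A : (Fin (d+1) → ℝ) × ℝ → ℝ) (G : (Fin (d+1) → ℝ) × ℝ × ℝ → ℝ),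
      ContDiff ℝ 1 A ∧ GoodAlong ((0, -ω j, 1) : (Fin (d+1) → ℝ) × ℝ × ℝ) G ∧
      ∀ p, l j ⬝ᵥ F p = A (projA d (ω j) p) + G p := by
  obtain ⟨f, g, h, hf, hg, hh, hFeq⟩ := hF
  refine ⟨fun q => f j j q + g j j j q * h j j j q,
    fun p => (∑ k : Fin 3, if k = j then 0 else f j k (projA d (ω k) p)) +
      ∑ lo : Fin 3, ∑ m : Fin 3, if lo ≤ m then (if lo = j then (if m = j then 0 else
        h j lo m (projA d (ω m) p) * g j lo m (projA d (ω lo) p)) else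
        g j lo m (projA d (ω lo) p) * h j lo m (projA d (ω m) p)) else 0,
    (hf j j).1.add ((hg j j j).1.mul (hh j j j).1), ?_, ?_⟩
  · refine GoodAlong.add (GoodAlong.sum _ fun k _ => ?_)
      (GoodAlong.sum _ fun lo _ => GoodAlong.sum _ fun m _ => ?_)
    · split_ifs with hk
      · exact GoodAlong.zero
      · exact (hf j k).good (fun e => hk (hω e))
    · split_ifs with h1 h2 h3
      · exact GoodAlong.zero
      · obtain ⟨M, hM⟩ := (hg j lo m).comp_bdd (ω lo)
        exact ((hh j lo m).good (fun e => h3 (hω e))).mul_bdd ((hg j lo m).contDiff_comp _) hM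
      · obtain ⟨M, hM⟩ := (hh j lo m).comp_bdd (ω m)
        exact ((hg j lo m).good (fun e => h2 (hω e))).mul_bdd ((hh j lo m).contDiff_comp _) hM
      · exact GoodAlong.zero
  · rintro ⟨x, θ, ξ⟩
    rw [hFeq, dot_sum l r hdual]
    simp only [projA_apply]
    fin_cases j <;> simp [Fin.sum_univ_three] <;> ring

lemma line_eq (w θ ξ s : ℝ) (x : Fin (d+1) → ℝ) :
    ((x, θ + w * (ξ - s), s) : (Fin (d+1) → ℝ) × ℝ × ℝ) =
      (x, θ + w * ξ, 0) + s • ((0, -w, 1) : (Fin (d+1) → ℝ) × ℝ × ℝ) := by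
  ext <;> simp
  ring

lemma point_eq (w θ ξ : ℝ) (x : Fin (d+1) → ℝ) :
    ((x, θ, ξ) : (Fin (d+1) → ℝ) × ℝ × ℝ) =
      (x, θ + w * ξ, 0) + ξ • ((0, -w, 1) : (Fin (d+1) → ℝ) × ℝ × ℝ) := by
  ext <;> simp
  ring

lemma partials {W : (Fin (d+1) → ℝ) × ℝ × ℝ → ℝ} {x : Fin (d+1) → ℝ} {θ ξ : ℝ} (w : ℝ)
    (hW : DifferentiableAt ℝ W (x, θ, ξ)) :
    ∃ A B : ℝ, HasDerivAt (fun u : ℝ => W (x, u, ξ)) A θ ∧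
      HasDerivAt (fun u : ℝ => W (x, θ, u)) B ξ ∧
      B - w * A = fderiv ℝ W (x, θ, ξ) (0, -w, 1) := by
  refine ⟨fderiv ℝ W (x, θ, ξ) (0, 1, 0), fderiv ℝ W (x, θ, ξ) (0, 0, 1), ?_, ?_, ?_⟩
  · have h1 : HasDerivAt (fun u : ℝ => ((x, u, ξ) : (Fin (d+1) → ℝ) × ℝ × ℝ)) (0, 1, 0) θ :=
      (hasDerivAt_const θ x).prodMk ((hasDerivAt_id θ).prodMk (hasDerivAt_const θ ξ))
    exact hW.hasFDerivAt.comp_hasDerivAt θ h1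
  · have h1 : HasDerivAt (fun u : ℝ => ((x, θ, u) : (Fin (d+1) → ℝ) × ℝ × ℝ)) (0, 0, 1) ξ :=
      (hasDerivAt_const ξ x).prodMk ((hasDerivAt_const ξ θ).prodMk (hasDerivAt_id ξ))
    exact hW.hasFDerivAt.comp_hasDerivAt ξ h1
  · have : ((0, -w, 1) : (Fin (d+1) → ℝ) × ℝ × ℝ) = (0, 0, 1) - w • (0, 1, 0) := by
      ext <;> simp
    rw [this, map_sub, map_smul, smul_eq_mul]

lemma fderiv_of_partials {W : (Fin (d+1) → ℝ) × ℝ × ℝ → ℝ} {x : Fin (d+1) → ℝ} {θ ξ w c : ℝ}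
    (hW : DifferentiableAt ℝ W (x, θ, ξ))
    (h : ∃ A B : ℝ, HasDerivAt (fun u : ℝ => W (x, u, ξ)) A θ ∧
      HasDerivAt (fun u : ℝ => W (x, θ, u)) B ξ ∧ B - w * A = c) :
    fderiv ℝ W (x, θ, ξ) (0, -w, 1) = c := by
  obtain ⟨A, B, hA, hB, hAB⟩ := h
  obtain ⟨A', B', hA', hB', hAB'⟩ := partials w hW
  rw [← hAB', ← hAB, hA.unique hA', hB.unique hB']

lemma line_ftc {E : Type*} [NormedAddCommGroup E] [NormedSpace ℝ E] {W Φ : E → ℝ} {p v : E}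
    (hW : ContDiff ℝ 1 W) {S : ℝ} (hS : 0 ≤ S)
    (h : ∀ s : ℝ, 0 ≤ s → fderiv ℝ W (p + s • v) v = Φ (p + s • v)) :
    ∫ s in (0:ℝ)..S, Φ (p + s • v) = W (p + S • v) - W p := by
  have h1 : ∫ s in (0:ℝ)..S, Φ (p + s • v) = ∫ s in (0:ℝ)..S, fderiv ℝ W (p + s • v) v := by
    refine intervalIntegral.integral_congr fun s hs => ?_
    rw [uIcc_of_le hS] at hs
    exact (h s hs.1).symm
  rw [h1, intervalIntegral.integral_eq_sub_of_hasDerivAt (f := fun s => W (p + s • v))]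
  · simp
  · intro s _
    have hl : HasDerivAt (fun a : ℝ => p + a • v) v s := by
      simpa using ((hasDerivAt_id s).smul_const v).const_add p
    exact HasFDerivAt.comp_hasDerivAt s
      (hW.differentiable (by norm_num) (p + s • v)).hasFDerivAt hl
  · have hfc : Continuous (fderiv ℝ W) := hW.continuous_fderiv (by norm_num)
    exact Continuous.intervalIntegrable (by fun_prop) _ _

lemma contDiff_dot {E : Type*} [NormedAddCommGroup E] [NormedSpace ℝ E] {U : E → Fin 3 → ℝ}
    (hU : ContDiff ℝ 1 U) (c : Fin 3 → ℝ) : ContDiff ℝ 1 (fun p => c ⬝ᵥ U p) := by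
  simp only [dotProduct]
  exact ContDiff.sum fun i _ => contDiff_const.mul (contDiff_pi.1 hU i)

lemma dot_le (c u : Fin 3 → ℝ) {C : ℝ} (hu : ‖u‖ ≤ C) : |c ⬝ᵥ u| ≤ (∑ i, |c i|) * C := by
  rw [dotProduct, Finset.sum_mul]
  refine (Finset.abs_sum_le_sum_abs _ _).trans (Finset.sum_le_sum fun i _ => ?_)
  rw [abs_mul]
  exact mul_le_mul_of_nonneg_left ((norm_le_pi_norm u i).trans hu) (abs_nonneg _)

end special

/-- **Proposition 1.10 (Proposition \ref{31}).**  Solvability of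
`L̃(∂_{θ₀},∂_{ξ_d})𝒰 = F` for `F` of type `ℱ`:
(a) a bounded `C¹` solution exists iff `𝐄F = 0`;
(b) when `𝐄F = 0`, every bounded `C¹` solution has the form
`𝒰 = Σᵢ τᵢ(x,θ₀+ωᵢξ_d) rᵢ + 𝐑_∞F` with `τᵢ` `C¹` and bounded, and
`𝐄𝒰 = Σᵢ τᵢ(x,θ₀+ωᵢξ_d) rᵢ`, `(I-𝐄)𝒰 = 𝐑_∞F`;
(c) if `𝒰` is of type `ℱ`, `C¹`, and `L̃𝒰` is of type `ℱ`, then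
`𝐄(L̃𝒰) = 0` and `L̃(𝐄𝒰) = 0`. -/
theorem Ltilde_solvability
    (d : ℕ) (ω : Fin 3 → ℝ) (hω : Function.Injective ω)
    (r l : Fin 3 → Fin 3 → ℝ)
    (hdual : ∀ i k, l i ⬝ᵥ r k = if i = k then (1 : ℝ) else 0)
    (F : (Fin (d+1) → ℝ) × ℝ × ℝ → Fin 3 → ℝ)
    (hF : IsTypeF d ω r F) :
    ((∃ U : (Fin (d+1) → ℝ) × ℝ × ℝ → Fin 3 → ℝ,
        ContDiff ℝ 1 U ∧
        (∃ C : ℝ, ∀ (x : Fin (d+1) → ℝ) (θ₀ ξd : ℝ), 0 ≤ ξd → ‖U (x, θ₀, ξd)‖ ≤ C) ∧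
        SolvesLtilde d ω l U F)
      ↔ EZero d ω l F) ∧
    (EZero d ω l F →
      ∀ U : (Fin (d+1) → ℝ) × ℝ × ℝ → Fin 3 → ℝ,
        ContDiff ℝ 1 U →
        (∃ C : ℝ, ∀ (x : Fin (d+1) → ℝ) (θ₀ ξd : ℝ), 0 ≤ ξd → ‖U (x, θ₀, ξd)‖ ≤ C) →
        SolvesLtilde d ω l U F →
        ∃ τ : Fin 3 → (Fin (d+1) → ℝ) × ℝ → ℝ,
          (∀ i, ContDiff ℝ 1 (τ i) ∧ ∃ C : ℝ, ∀ q, |τ i q| ≤ C) ∧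
          (∀ (x : Fin (d+1) → ℝ) (θ₀ ξd : ℝ), 0 ≤ ξd →
            U (x, θ₀, ξd) = (∑ i : Fin 3, τ i (x, θ₀ + ω i * ξd) • r i)
              + Rinf3 d ω l r F (x, θ₀, ξd)) ∧
          (∀ (j : Fin 3) (x : Fin (d+1) → ℝ) (θ₀ ξd : ℝ), 0 ≤ ξd →
            Tendsto (fun S : ℝ =>
                S⁻¹ * ∫ s in (0:ℝ)..S, l j ⬝ᵥ U (x, θ₀ + ω j * (ξd - s), s))
              atTop (𝓝 (τ j (x, θ₀ + ω j * ξd))))) ∧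
    (ContDiff ℝ 1 F → IsTypeF d ω r (LtildeTheta d ω l r F) →
      EZero d ω l (LtildeTheta d ω l r F) ∧
      ∃ τ : Fin 3 → (Fin (d+1) → ℝ) × ℝ → ℝ,
        (∀ (j : Fin 3) (x : Fin (d+1) → ℝ) (θ₀ ξd : ℝ), 0 ≤ ξd →
          Tendsto (fun S : ℝ =>
              S⁻¹ * ∫ s in (0:ℝ)..S, l j ⬝ᵥ F (x, θ₀ + ω j * (ξd - s), s))
            atTop (𝓝 (τ j (x, θ₀ + ω j * ξd)))) ∧
        SolvesLtilde d ω l (fun p => ∑ i : Fin 3, τ i (p.1, p.2.1 + ω i * p.2.2) • r i)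
          (fun _ => 0)) := by
  classical
  choose A G hA hG hAG using fun j => decomp ω hω r l hdual F hF j
  -- averages of `F` along characteristics
  have havg : ∀ (j : Fin 3) (x : Fin (d+1) → ℝ) (θ₀ ξd : ℝ),
      Tendsto (fun S : ℝ => S⁻¹ * ∫ s in (0:ℝ)..S, l j ⬝ᵥ F (x, θ₀ + ω j * (ξd - s), s))
        atTop (𝓝 (A j (x, θ₀ + ω j * ξd))) := by
    intro j x θ₀ ξd
    have h := avg_const_add ((hG j).cont_line (x, θ₀ + ω j * ξd, 0))
      (c := A j (x, θ₀ + ω j * ξd)) ((hG j).avg_zero (x, θ₀ + ω j * ξd, 0))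
    rw [add_zero] at h
    refine h.congr fun S => ?_
    congr 2
    ext s
    rw [line_eq, hAG, projA_line, projA_apply]
    simp
  have hA0 : EZero d ω l F → ∀ j q, A j q = 0 := by
    intro h j q
    have h1 := tendsto_nhds_unique (havg j q.1 q.2 0) (h j q.1 q.2 0)
    simpa using h1
  have hlG : EZero d ω l F → ∀ j p, l j ⬝ᵥ F p = G j p := by
    intro h j p
    rw [hAG, hA0 h, zero_add]
  -- directional derivative of solutions
  have hdir : ∀ (U Φ : (Fin (d+1) → ℝ) × ℝ × ℝ → Fin 3 → ℝ), ContDiff ℝ 1 U →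
      SolvesLtilde d ω l U Φ → ∀ (i : Fin 3) (x : Fin (d+1) → ℝ) (θ S : ℝ), 0 ≤ S →
      ∫ s in (0:ℝ)..S, l i ⬝ᵥ Φ ((x, θ, 0) + s • ((0, -ω i, 1) : (Fin (d+1) → ℝ) × ℝ × ℝ)) =
        l i ⬝ᵥ U ((x, θ, 0) + S • ((0, -ω i, 1) : (Fin (d+1) → ℝ) × ℝ × ℝ))
          - l i ⬝ᵥ U (x, θ, 0) := by
    intro U Φ hU hs i x θ S hS
    refine line_ftc (W := fun p => l i ⬝ᵥ U p) (Φ := fun p => l i ⬝ᵥ Φ p)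
      (contDiff_dot hU (l i)) hS fun s hs0 => ?_
    have e : ((x, θ, 0) + s • ((0, -ω i, 1) : (Fin (d+1) → ℝ) × ℝ × ℝ)) =
      (x, θ + s * (-ω i), s) := by ext <;> simp
    rw [e]
    exact fderiv_of_partials ((contDiff_dot hU (l i)).differentiable (by norm_num) _)
      (hs i x (θ + s * (-ω i)) s hs0)
  refine ⟨⟨?_, ?_⟩, ?_, ?_⟩
  · rintro ⟨U, hU, ⟨C, hC⟩, hs⟩ j x θ₀ ξd
    simp only [line_eq]
    refine avg_zero_of_bdd (C := (∑ i, |l j i|) * C + (∑ i, |l j i|) * C) fun S hS => ?_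
    rw [hdir U F hU hs j x _ S hS, ← line_eq]
    exact (abs_sub _ _).trans (add_le_add (dot_le _ _ (hC _ _ _ hS)) (dot_le _ _ (hC _ _ _ le_rfl)))
  · intro hE
    refine ⟨fun p => ∑ i : Fin 3, (-halfInt ((0, -ω i, 1) : (Fin (d+1) → ℝ) × ℝ × ℝ) (G i) p) • r i,
      ?_, ?_, ?_⟩
    · exact ContDiff.sum fun i _ => ((hG i).halfInt_contDiff.neg).smul contDiff_const
    · choose C hC using fun i => (hG i).halfInt_bdd
      refine ⟨∑ i, C i * ‖r i‖, fun x θ₀ ξd _ => ?_⟩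
      refine (norm_sum_le _ _).trans (Finset.sum_le_sum fun i _ => ?_)
      rw [norm_smul, norm_neg]
      exact mul_le_mul_of_nonneg_right (hC i _) (norm_nonneg _)
    · intro i x θ₀ ξd _
      simp only [dot_sum l r hdual]
      have hd := (hG i).halfInt_contDiff.neg.differentiable (by norm_num) (x, θ₀, ξd)
      obtain ⟨a, b, ha, hb, hab⟩ := partials (ω i) hd
      refine ⟨a, b, ha, hb, ?_⟩
      rw [hab, hlG hE]
      have := (hG i).halfInt_fderiv (x, θ₀, ξd)
      rw [fderiv_fun_neg]
      simp [this]
  · intro hE U hU ⟨C, hC⟩ hs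
    have hrep : ∀ (i : Fin 3) (x : Fin (d+1) → ℝ) (θ ξ : ℝ), 0 ≤ ξ →
        l i ⬝ᵥ U ((x, θ, 0) + ξ • ((0, -ω i, 1) : (Fin (d+1) → ℝ) × ℝ × ℝ)) =
        (l i ⬝ᵥ U (x, θ, 0) + halfInt ((0, -ω i, 1) : (Fin (d+1) → ℝ) × ℝ × ℝ) (G i) (x, θ, 0))
        + -halfInt ((0, -ω i, 1) : (Fin (d+1) → ℝ) × ℝ × ℝ) (G i)
          ((x, θ, 0) + ξ • ((0, -ω i, 1) : (Fin (d+1) → ℝ) × ℝ × ℝ)) := by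
      intro i x θ ξ hξ
      have h1 := hdir U F hU hs i x θ ξ hξ
      simp only [hlG hE] at h1
      have h2 := (hG i).halfInt_line (x, θ, 0) ξ
      linarith
    refine ⟨fun i q => l i ⬝ᵥ U (q.1, q.2, 0) +
      halfInt ((0, -ω i, 1) : (Fin (d+1) → ℝ) × ℝ × ℝ) (G i) (q.1, q.2, 0), ?_, ?_, ?_⟩
    · intro i
      refine ⟨?_, ?_⟩
      · have hι : ContDiff ℝ 1 (fun q : (Fin (d+1) → ℝ) × ℝ =>
            ((q.1, q.2, 0) : (Fin (d+1) → ℝ) × ℝ × ℝ)) := by fun_prop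
        exact ((contDiff_dot hU (l i)).comp hι).add ((hG i).halfInt_contDiff.comp hι)
      · obtain ⟨K, hK⟩ := (hG i).halfInt_bdd
        exact ⟨(∑ k, |l i k|) * C + K, fun q => (abs_add_le _ _).trans
          (add_le_add (dot_le _ _ (hC _ _ _ le_rfl)) (hK _))⟩
    · intro x θ₀ ξd hξ
      have hR : Rinf3 d ω l r F (x, θ₀, ξd) = ∑ i : Fin 3,
          (-halfInt ((0, -ω i, 1) : (Fin (d+1) → ℝ) × ℝ × ℝ) (G i) (x, θ₀, ξd)) • r i := by
        simp only [Rinf3, neg_smul, Finset.sum_neg_distrib, hlG hE]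
        congr 1
        refine Finset.sum_congr rfl fun i _ => ?_
        congr 1
        rw [point_eq (ω i) θ₀ ξd x, halfInt_shift, integral_Ici_eq_integral_Ioi]
        simp only [line_eq]
      rw [hR, ← Finset.sum_add_distrib]
      conv_lhs => rw [expand l r hdual (U (x, θ₀, ξd))]
      refine Finset.sum_congr rfl fun i _ => ?_
      rw [← add_smul]
      congr 1
      have := hrep i x (θ₀ + ω i * ξd) ξd hξ
      rw [← point_eq] at this
      exact this
    · intro j x θ₀ ξd _
      simp only [line_eq]
      have h0 := (hG j).halfInt_tendsto (x, θ₀ + ω j * ξd, 0)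
      have hc : Continuous (fun s : ℝ => -halfInt ((0, -ω j, 1) : (Fin (d+1) → ℝ) × ℝ × ℝ) (G j)
          ((x, θ₀ + ω j * ξd, 0) + s • ((0, -ω j, 1) : (Fin (d+1) → ℝ) × ℝ × ℝ))) :=
        ((hG j).halfInt_contDiff.continuous.comp (by fun_prop)).neg
      have h1 := avg_const_add hc (c := l j ⬝ᵥ U (x, θ₀ + ω j * ξd, 0) +
        halfInt ((0, -ω j, 1) : (Fin (d+1) → ℝ) × ℝ × ℝ) (G j) (x, θ₀ + ω j * ξd, 0))
        (avg_zero_of_tendsto hc (by simpa using h0.neg))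
      rw [add_zero] at h1
      refine h1.congr' ?_
      filter_upwards [eventually_ge_atTop 0] with S hS
      congr 1
      refine intervalIntegral.integral_congr fun s hs' => ?_
      rw [uIcc_of_le hS] at hs'
      exact (hrep j x (θ₀ + ω j * ξd) s hs'.1).symm
  · intro hFc _
    have hLt : ∀ (j : Fin 3) p, l j ⬝ᵥ LtildeTheta d ω l r F p =
        fderiv ℝ (fun p => l j ⬝ᵥ F p) p (0, -ω j, 1) := by
      rintro j ⟨x, θ, ξ⟩
      have hW := ((contDiff_dot hFc (l j)).differentiable (by norm_num) (x, θ, ξ)).hasFDerivAt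
      have hι : HasFDerivAt (fun q : ℝ × ℝ => ((x, q.1, q.2) : (Fin (d+1) → ℝ) × ℝ × ℝ))
          (ContinuousLinearMap.inr ℝ (Fin (d+1) → ℝ) (ℝ × ℝ)) (θ, ξ) :=
        hasFDerivAt_prodMk_right x (θ, ξ)
      have hcomp : HasFDerivAt (fun q : ℝ × ℝ => l j ⬝ᵥ F (x, q.1, q.2))
          ((fderiv ℝ (fun p => l j ⬝ᵥ F p) (x, θ, ξ)).comp
            (ContinuousLinearMap.inr ℝ (Fin (d+1) → ℝ) (ℝ × ℝ))) (θ, ξ) := hW.comp (θ, ξ) hι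
      have hv : ((0, -ω j, 1) : (Fin (d+1) → ℝ) × ℝ × ℝ) = (0, 0, 1) - ω j • (0, 1, 0) := by
        ext <;> simp
      rw [LtildeTheta, dot_sum l r hdual]
      simp only [hcomp.fderiv]
      rw [hv, map_sub, map_smul, smul_eq_mul]
      simp
    refine ⟨?_, A, fun j x θ₀ ξd _ => havg j x θ₀ ξd, ?_⟩
    · intro j x θ₀ ξd
      simp only [line_eq]
      obtain ⟨C, hC⟩ := (hG j).2.1 ‖((x, θ₀ + ω j * ξd, 0) : (Fin (d+1) → ℝ) × ℝ × ℝ)‖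
      have hb : ∀ s : ℝ, |l j ⬝ᵥ F ((x, θ₀ + ω j * ξd, 0) +
          s • ((0, -ω j, 1) : (Fin (d+1) → ℝ) × ℝ × ℝ))| ≤ |A j (x, θ₀ + ω j * ξd)| + |C| := by
        intro s
        rw [hAG, projA_line, projA_apply]
        refine (abs_add_le _ _).trans (add_le_add (by simp) ?_)
        refine (hC _ s le_rfl).1.trans ?_
        have h1 : (1 + s ^ 2)⁻¹ ≤ 1 := inv_le_one_of_one_le₀ (by nlinarith [sq_nonneg s])
        have h2 : 0 ≤ (1 + s ^ 2)⁻¹ := by positivity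
        nlinarith [le_abs_self C, abs_nonneg C]
      refine avg_zero_of_bdd (C := (|A j (x, θ₀ + ω j * ξd)| + |C|) +
        (|A j (x, θ₀ + ω j * ξd)| + |C|)) fun S hS => ?_
      rw [line_ftc (W := fun p => l j ⬝ᵥ F p) (Φ := fun p => l j ⬝ᵥ LtildeTheta d ω l r F p)
        (contDiff_dot hFc (l j)) hS fun s _ => (hLt j _).symm]
      have h0 := hb 0
      rw [zero_smul, add_zero] at h0
      exact (abs_sub _ _).trans (add_le_add (hb S) h0)
    · intro i x θ₀ ξd _
      simp only [dot_sum l r hdual]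
      have hAd := ((hA i).differentiable (by norm_num) (x, θ₀ + ω i * ξd)).hasFDerivAt
      refine ⟨fderiv ℝ (A i) (x, θ₀ + ω i * ξd) (0, 1),
        fderiv ℝ (A i) (x, θ₀ + ω i * ξd) (0, ω i), ?_, ?_, ?_⟩
      · have h1 : HasDerivAt (fun u : ℝ => ((x, u + ω i * ξd) : (Fin (d+1) → ℝ) × ℝ)) (0, 1) θ₀ :=
          (hasDerivAt_const θ₀ x).prodMk ((hasDerivAt_id θ₀).add_const _)
        exact hAd.comp_hasDerivAt θ₀ h1
      · have h1 : HasDerivAt (fun u : ℝ => ((x, θ₀ + ω i * u) : (Fin (d+1) → ℝ) × ℝ))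
            (0, ω i) ξd := by
          refine (hasDerivAt_const ξd x).prodMk ?_
          simpa using ((hasDerivAt_id ξd).const_mul (ω i)).const_add θ₀
        exact hAd.comp_hasDerivAt ξd h1
      · have : ((0, ω i) : (Fin (d+1) → ℝ) × ℝ) = ω i • (0, 1) := by ext <;> simp
        rw [this, map_smul, smul_eq_mul]
        simp

end
end
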